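/- Let X be a compact Hausdorff scattered topological space, γ an ordinal, and for each ξ < γ let C_ξ be a family of clopen subsets of X. Then the tree T(⟨C_ξ : ξ < γ⟩) (formed with D = X) is well-founded: there is no sequence ⟨ξ_i : i < ω⟩ of pairwise distinct ordinals below γ together with an independent ω-sequence ⟨H_i : i < ω⟩ with each H_i ∈ C_{ξ_i}. -/

import Mathlib

open Set

/-- The set of points of `A` that are isolated in the subspace `A`. -/
def isolatedIn {X : Type*} [TopologicalSpace X] (A : Set X) : Set X :=
  {x | x ∈ A ∧ ∃ U : Set X, IsOpen U ∧ U ∩ A = {x}}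

/-- A space is scattered iff every nonempty subset has a point isolated in it. -/
def Scattered (X : Type*) [TopologicalSpace X] : Prop :=
  ∀ A : Set X, A.Nonempty → (isolatedIn A).Nonempty

/-- `piece K b` is `K` if `b = false` and the complement of `K` if `b = true`. -/
def piece {D : Type*} (K : Set D) (b : Bool) : Set D := if b then Kᶜ else K

/-- Independence for an `ω`-sequence of subsets. -/
def IndepSeq {D : Type*} (K : ℕ → Set D) : Prop :=
  ∀ (n : ℕ) (s : Fin n → Bool), (⋂ i : Fin n, piece (K i) (s i)).Nonempty

/-- Independence for a finite sequence of subsets. -/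
def IndepFin {D : Type*} {n : ℕ} (K : Fin n → Set D) : Prop :=
  ∀ (m : ℕ) (hm : m ≤ n) (s : Fin m → Bool),
    (⋂ i : Fin m, piece (K (Fin.castLE hm i)) (s i)).Nonempty

/-- Independence for a list of subsets. -/
def IndepList {D : Type*} (L : List (Set D)) : Prop :=
  IndepFin (fun i : Fin L.length => L.get i)

/-- A subalgebra of the power set: contains the whole set and is closed under
complements and finite unions. -/
def IsSubalgebra {D : Type*} (A : Set (Set D)) : Prop :=
  Set.univ ∈ A ∧ (∀ s ∈ A, sᶜ ∈ A) ∧ (∀ s ∈ A, ∀ t ∈ A, s ∪ t ∈ A)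

/-- `A` separates the points of `E`. -/
def SeparatesPts {D : Type*} (A : Set (Set D)) (E : Set D) : Prop :=
  ∀ a ∈ E, ∀ b ∈ E, a ≠ b → ∃ H ∈ A, a ∈ H ∧ b ∉ H

/-- Nodes of the tree `T(⟨C ξ : ξ < γ⟩)`. -/
structure TNode (D : Type*) (γ : Ordinal) (C : Ordinal → Set (Set D)) where
  xs : List Ordinal
  hs : List (Set D)
  len_eq : xs.length = hs.length
  nodup : xs.Nodup
  lt : ∀ ξ ∈ xs, ξ < γ
  mem : ∀ i : Fin xs.length, hs.get (Fin.cast len_eq i) ∈ C (xs.get i)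
  indep : IndepList hs

/-- `TExt y x` : `y` is a proper extension of `x` in the tree (so `y` lies
strictly below `x`, the root `(∅,∅)` being the top). -/
def TExt {D : Type*} {γ : Ordinal} {C : Ordinal → Set (Set D)}
    (y x : TNode D γ C) : Prop :=
  x.xs <+: y.xs ∧ x.hs <+: y.hs ∧ x.xs.length < y.xs.length

/-- Ordinal–indexed Cantor–Bendixson derivatives. -/
noncomputable def CBD (X : Type*) [TopologicalSpace X] : Ordinal → Set X := fun o =>
  o.limitRecOn Set.univ (fun _ S => S \ isolatedIn S)
    (fun o _ ih => ⋂ p : {o' : Ordinal // o' < o}, ih p p.2)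

/-- The Cantor–Bendixson height: the least `α` with `CBD X α = ∅`. -/
noncomputable def hgt (X : Type*) [TopologicalSpace X] : Ordinal :=
  sInf {α : Ordinal | CBD X α = ∅}

theorem mem_piece_iff {D : Type*} (K : Set D) (b : Bool) (x : D) :
    x ∈ piece K b ↔ Kᶜ.boolIndicator x = b := by
  by_cases hx : x ∈ K <;> cases b <;> simp [piece, Set.boolIndicator, hx]

/-- The Cantor space has no isolated points. -/
theorem not_isOpen_singleton_cantor (y : ℕ → Bool) : ¬ IsOpen ({y} : Set (ℕ → Bool)) := by
  intro h
  obtain ⟨I, u, hu, hsub⟩ := isOpen_pi_iff.mp h y rfl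
  obtain ⟨n, hn⟩ := I.exists_notMem
  have hmem : Function.update y n (!y n) ∈ (I : Set ℕ).pi u := by
    intro i hi
    have hin : i ≠ n := fun e => hn (e ▸ hi)
    simpa [Function.update_of_ne hin] using (hu i hi).2
  have heq := congrFun (hsub hmem) n
  simp at heq

/-- A compact scattered space has no continuous surjection onto a Hausdorff space without isolated
points. -/
theorem Scattered.not_surjective.{u} {X Y : Type u} [TopologicalSpace X] [CompactSpace X]
    [TopologicalSpace Y] [T2Space Y] [Nonempty Y] (hX : Scattered X)
    (hY : ∀ y : Y, ¬ IsOpen ({y} : Set Y)) {f : X → Y} (hf : Continuous f) :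
    ¬ f.Surjective := by
  intro hsurj
  obtain ⟨E, hEc, hE, hmin⟩ := exists_compact_surjective_zorn_subset hf hsurj
  have hne : E.Nonempty := Set.image_nonempty.mp (hE ▸ Set.univ_nonempty)
  obtain ⟨x, hxE, U, hU, hUE⟩ := hX E hne
  have hxU : x ∈ U := (hUE.symm ▸ Set.mem_singleton x : x ∈ U ∩ E).1
  set E₀ : Set E := (Subtype.val ⁻¹' U)ᶜ
  have hclosed : IsClosed E₀ := (hU.preimage continuous_subtype_val).isClosed_compl
  refine hmin E₀ (fun h => ?_) hclosed ?_
  · exact (h ▸ Set.mem_univ (⟨x, hxE⟩ : E) : (⟨x, hxE⟩ : E) ∈ E₀) hxU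
  · have himg : IsClosed (E.domRestrict f '' E₀) :=
      (hclosed.isCompact.image hf.continuousOn.domRestrict).isClosed
    have hdense : Dense ({f x}ᶜ : Set Y) := dense_compl_singleton_iff_not_open.mpr (hY _)
    refine Set.univ_subset_iff.mp (hdense.closure_eq ▸ closure_minimal ?_ himg)
    intro y hy
    obtain ⟨z, hzE, rfl⟩ : y ∈ f '' E := hE ▸ Set.mem_univ y
    refine ⟨⟨z, hzE⟩, fun hzU => hy ?_, rfl⟩
    have hzx : z ∈ ({x} : Set X) := hUE ▸ ⟨hzU, hzE⟩
    exact congrArg f hzx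

/-- The map to the Cantor space given by an independent sequence has dense range. -/
theorem IndepSeq.denseRange {D : Type*} {H : ℕ → Set D} (hH : IndepSeq H) :
    DenseRange fun (x : D) (i : ℕ) => (H i)ᶜ.boolIndicator x := by
  refine dense_iff_inter_open.mpr fun V hV ⟨y, hy⟩ => ?_
  obtain ⟨I, u, hu, hsub⟩ := isOpen_pi_iff.mp hV y hy
  obtain ⟨x, hx⟩ := hH (I.sup id + 1) fun i => y i
  refine ⟨_, hsub fun i hi => ?_, x, rfl⟩
  have hlt : i < I.sup id + 1 := Nat.lt_succ_of_le (Finset.le_sup (f := id) hi)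
  have hxi : (H i)ᶜ.boolIndicator x = y i := (mem_piece_iff _ _ _).mp (Set.mem_iInter.mp hx ⟨i, hlt⟩)
  simpa only [hxi] using (hu i hi).2

/-- for families of clopen subsets of a compact Hausdorff scattered
space, the tree T(⟨C ξ : ξ < γ⟩) is well-founded: there is no infinite branch. -/
theorem stmt_4 {X : Type*} [TopologicalSpace X] [CompactSpace X] [T2Space X]
    (hX : Scattered X) (γ : Ordinal) (C : Ordinal → Set (Set X))
    (hC : ∀ ξ < γ, ∀ A ∈ C ξ, IsClopen A) :
    ¬ ∃ (ξ : ℕ → Ordinal) (H : ℕ → Set X),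
        Function.Injective ξ ∧ (∀ i, ξ i < γ) ∧ (∀ i, H i ∈ C (ξ i)) ∧
        IndepSeq H := by
  rintro ⟨ξ, H, -, hlt, hmem, hind⟩
  have hcont : Continuous fun (x : X) (i : ℕ) => (H i)ᶜ.boolIndicator x :=
    continuous_pi fun i =>
      (continuous_boolIndicator_iff_isClopen _).mpr (hC _ (hlt i) _ (hmem i)).compl
  refine hX.not_surjective (f := fun x => ULift.up fun i => (H i)ᶜ.boolIndicator x)
    (fun y hy => ?_) (continuous_uliftUp.comp hcont) (ULift.up_surjective.comp ?_)
  · refine not_isOpen_singleton_cantor y.down ?_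
    convert hy.preimage continuous_uliftUp
    ext z
    simp [ULift.ext_iff]
  · rw [← Set.range_eq_univ, ← (isCompact_range hcont).isClosed.closure_eq]
    exact hind.denseRange.closure_eq
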